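/- Let ℱ be the d × d Fourier matrix with entries ℱ_{jk} = exp(2π𝐢·jk/d) (all of modulus 1). Let Ω = {t_1,…,t_B} be a random multiset obtained by choosing t_1,…,t_B ∈ [d] independently and uniformly at random, and for S ⊆ [d] let ℱ_{Ω×S} be the B × |S| matrix whose rows are the rows of ℱ indexed by Ω restricted to the columns in S. Set β = log² k · log d · log B. Then there exist absolute constants C, C', c > 0 such that for every t > 1, with probability at least 1 − C' exp(−c·min{t², tβ}), one has max_{S⊆[d], |S|=k} ‖ℱ_{Ω×S}‖_{2→2} ≤ C √(t(B + kβ)). -/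

import Mathlib

open MeasureTheory Finset

noncomputable section

/-- Euclidean norm of a complex vector. -/
def l2norm {n : ℕ} (x : Fin n → ℂ) : ℝ := Real.sqrt (∑ i, ‖x i‖ ^ 2)

/-- Matrix-vector multiplication. -/
def mvec {n d : ℕ} (A : Fin n → Fin d → ℂ) (x : Fin d → ℂ) : Fin n → ℂ :=
  fun r => ∑ j, A r j * x j

/-- The d × d Fourier matrix, `ℱ_{jk} = exp(2π𝐢·jk/d)`. -/
def Fmat (d : ℕ) : Fin d → Fin d → ℂ :=
  fun j k => Complex.exp (2 * Real.pi * Complex.I * (j.1 : ℂ) * (k.1 : ℂ) / (d : ℂ))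

theorem sum_prod_mul_exp_le {ι : Type*} [Fintype ι] (w a : ι → ℝ) (hw : ∀ i, 0 ≤ w i)
    (hw1 : ∑ i, w i = 1) (ha : ∀ i, |a i| ≤ 2) (ha0 : ∑ i, w i * a i = 0) {u : ℝ}
    (hu : |u| ≤ 1 / 2) (L : ℕ) :
    ∑ τ : Fin L → ι, (∏ l, w (τ l)) * Real.exp (u * ∑ l, a (τ l))
      ≤ Real.exp (4 * u ^ 2 * L) := by
  have h1 : ∀ i, w i * Real.exp (u * a i) ≤ w i + u * (w i * a i) + w i * (4 * u ^ 2) := by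
    intro i
    have hb : |u * a i| ≤ 1 := by
      rw [abs_mul]
      nlinarith [abs_nonneg u, abs_nonneg (a i), ha i]
    have h2 := (abs_le.1 (Real.abs_exp_sub_one_sub_id_le hb)).2
    have h3 : (u * a i) ^ 2 ≤ 4 * u ^ 2 := by
      have : a i ^ 2 ≤ 4 := by
        have := abs_le.1 (ha i)
        nlinarith
      rw [mul_pow]
      nlinarith [sq_nonneg u]
    nlinarith [hw i]
  have h2 : ∑ i, w i * Real.exp (u * a i) ≤ Real.exp (4 * u ^ 2) := by
    calc _ ≤ ∑ i, (w i + u * (w i * a i) + w i * (4 * u ^ 2)) := sum_le_sum fun i _ => h1 i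
      _ = 4 * u ^ 2 + 1 := by
        rw [sum_add_distrib, sum_add_distrib, ← mul_sum, ← sum_mul, hw1, ha0]; ring
      _ ≤ _ := Real.add_one_le_exp _
  calc _ = ∑ τ : Fin L → ι, ∏ l, (w (τ l) * Real.exp (u * a (τ l))) := by
        refine sum_congr rfl fun τ _ => ?_
        rw [mul_sum, Real.exp_sum, prod_mul_distrib]
    _ = (∑ i, w i * Real.exp (u * a i)) ^ L := by rw [Fintype.sum_pow]
    _ ≤ (Real.exp (4 * u ^ 2)) ^ L :=
        pow_le_pow_left₀ (sum_nonneg fun i _ => mul_nonneg (hw i) (Real.exp_pos _).le) h2 _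
    _ = _ := by rw [← Real.exp_nat_mul]; ring_nf

/-- Hoeffding-type tail bound for a sum of independent samples, drawn with weights `w`. -/
theorem sum_prod_mul_tail_le {ι : Type*} [Fintype ι] (w a : ι → ℝ) (hw : ∀ i, 0 ≤ w i)
    (hw1 : ∑ i, w i = 1) (ha : ∀ i, |a i| ≤ 2) (ha0 : ∑ i, w i * a i = 0) {δ : ℝ}
    (hδ : 0 ≤ δ) (hδ' : δ ≤ 4) (L : ℕ) :
    ∑ τ : Fin L → ι, (∏ l, w (τ l)) * (if δ * L ≤ |∑ l, a (τ l)| then 1 else 0)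
      ≤ 2 * Real.exp (-(L * δ ^ 2 / 16)) := by
  have hp := sum_prod_mul_exp_le w a hw hw1 ha ha0 (u := δ / 8)
    (by rw [abs_of_nonneg (by positivity)]; linarith) L
  have hm := sum_prod_mul_exp_le w a hw hw1 ha ha0 (u := -(δ / 8))
    (by rw [abs_neg, abs_of_nonneg (by positivity)]; linarith) L
  have key : ∀ τ : Fin L → ι,
      (∏ l, w (τ l)) * (if δ * L ≤ |∑ l, a (τ l)| then 1 else 0) ≤
      Real.exp (-(δ ^ 2 * L / 8)) * ((∏ l, w (τ l)) * Real.exp (δ / 8 * ∑ l, a (τ l)))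
      + Real.exp (-(δ ^ 2 * L / 8)) *
        ((∏ l, w (τ l)) * Real.exp (-(δ / 8) * ∑ l, a (τ l))) := by
    intro τ
    have hW : 0 ≤ ∏ l, w (τ l) := prod_nonneg fun l _ => hw _
    set s := ∑ l, a (τ l)
    have : (if δ * L ≤ |s| then (1 : ℝ) else 0) ≤
        Real.exp (-(δ ^ 2 * L / 8)) * Real.exp (δ / 8 * s)
        + Real.exp (-(δ ^ 2 * L / 8)) * Real.exp (-(δ / 8) * s) := by
      rw [← Real.exp_add, ← Real.exp_add]
      split_ifs with h
      · rcases le_abs.1 h with h | h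
        · have : 1 ≤ Real.exp (-(δ ^ 2 * L / 8) + δ / 8 * s) := by
            apply Real.one_le_exp; nlinarith
          linarith [Real.exp_pos (-(δ ^ 2 * L / 8) + -(δ / 8) * s)]
        · have : 1 ≤ Real.exp (-(δ ^ 2 * L / 8) + -(δ / 8) * s) := by
            apply Real.one_le_exp; nlinarith
          linarith [Real.exp_pos (-(δ ^ 2 * L / 8) + (δ / 8) * s)]
      · positivity
    calc _ ≤ _ := mul_le_mul_of_nonneg_left this hW
      _ = _ := by ring
  calc _ ≤ _ := sum_le_sum fun τ _ => key τ
    _ ≤ Real.exp (-(δ ^ 2 * L / 8)) * Real.exp (4 * (δ / 8) ^ 2 * L)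
        + Real.exp (-(δ ^ 2 * L / 8)) * Real.exp (4 * (-(δ / 8)) ^ 2 * L) := by
      rw [sum_add_distrib, ← mul_sum, ← mul_sum]
      gcongr
    _ = _ := by
      rw [← Real.exp_add, ← Real.exp_add, two_mul]
      ring_nf

/-- Maurey's empirical method: a convex combination of bounded functions is approximated by an
average of few of them, outside a set of small `v`-mass. -/
theorem exists_average_approx {ι Y : Type*} [Fintype ι] [Fintype Y] (φ : ι → Y → ℝ)
    (hφ : ∀ i y, |φ i y| ≤ 1) (w : ι → ℝ) (hw : ∀ i, 0 ≤ w i) (hw1 : ∑ i, w i = 1)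
    (v : Y → ℝ) (hv : ∀ y, 0 ≤ v y) {δ : ℝ} (hδ : 0 ≤ δ) (hδ' : δ ≤ 4) {L : ℕ} (hL : 0 < L) :
    ∃ τ : Fin L → ι,
      ∑ y, v y * (if δ ≤ |(∑ l, φ (τ l) y) / L - ∑ i, w i * φ i y| then 1 else 0)
        ≤ (∑ y, v y) * (2 * Real.exp (-(L * δ ^ 2 / 16))) := by
  by_contra! hcon
  have hL' : (0 : ℝ) < L := by exact_mod_cast hL
  set R := (∑ y, v y) * (2 * Real.exp (-(L * δ ^ 2 / 16)))
  have hW1 : ∑ τ : Fin L → ι, ∏ l, w (τ l) = 1 := by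
    rw [← Fintype.sum_pow, hw1, one_pow]
  have hWn : ∀ τ : Fin L → ι, 0 ≤ ∏ l, w (τ l) := fun τ => prod_nonneg fun l _ => hw _
  have hlt : R < ∑ τ : Fin L → ι, (∏ l, w (τ l)) *
      ∑ y, v y * (if δ ≤ |(∑ l, φ (τ l) y) / L - ∑ i, w i * φ i y| then 1 else 0) := by
    obtain ⟨τ₀, -, hτ₀⟩ : ∃ τ ∈ (univ : Finset (Fin L → ι)), 0 < ∏ l, w (τ l) := by
      apply exists_lt_of_sum_lt
      simp [hW1]
    calc R = ∑ τ : Fin L → ι, (∏ l, w (τ l)) * R := by rw [← sum_mul, hW1, one_mul]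
      _ < _ := sum_lt_sum (fun τ _ => mul_le_mul_of_nonneg_left (hcon τ).le (hWn τ))
        ⟨τ₀, mem_univ _, mul_lt_mul_of_pos_left (hcon τ₀) hτ₀⟩
  have hle : ∑ τ : Fin L → ι, (∏ l, w (τ l)) *
      ∑ y, v y * (if δ ≤ |(∑ l, φ (τ l) y) / L - ∑ i, w i * φ i y| then 1 else 0) ≤ R := by
    simp_rw [mul_sum]
    rw [sum_comm]
    simp only [R, sum_mul]
    refine sum_le_sum fun y _ => ?_
    set m := ∑ i, w i * φ i y with hm
    have hm1 : |m| ≤ 1 := by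
      calc |m| ≤ ∑ i, |w i * φ i y| := abs_sum_le_sum_abs _ _
        _ ≤ ∑ i, w i := sum_le_sum fun i _ => by
          rw [abs_mul, abs_of_nonneg (hw i)]
          exact mul_le_of_le_one_right (hw i) (hφ i y)
        _ = 1 := hw1
    have := sum_prod_mul_tail_le w (fun i => φ i y - m) hw hw1
      (fun i => (abs_sub _ _).trans (by linarith [hφ i y]))
      (by simp_rw [mul_sub]; rw [sum_sub_distrib, ← sum_mul, hw1, ← hm]; ring) hδ hδ' L
    calc _ = v y * ∑ τ : Fin L → ι, (∏ l, w (τ l)) *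
          (if δ * L ≤ |∑ l, (φ (τ l) y - m)| then 1 else 0) := by
          rw [mul_sum]
          refine sum_congr rfl fun τ _ => ?_
          have : δ ≤ |(∑ l, φ (τ l) y) / L - m| ↔ δ * L ≤ |∑ l, (φ (τ l) y - m)| := by
            have e : ∑ l, (φ (τ l) y - m) = ((∑ l, φ (τ l) y) / L - m) * L := by
              rw [sum_sub_distrib]; simp; field_simp
            rw [e, abs_mul, abs_of_pos hL', mul_le_mul_iff_left₀ hL']
          simp only [this]; ring
      _ ≤ _ := mul_le_mul_of_nonneg_left this (hv y)
  linarith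

/-- Chernoff bound, in counting form, for the number of samples falling into a set. -/
theorem card_filter_chernoff {X : Type*} [Fintype X] [DecidableEq X] [Nonempty X] (B : ℕ)
    (A : Finset X) (u : ℝ) :
    (#{Ω : Fin B → X | 2 * B * (#A / Fintype.card X : ℝ) + u ≤ #{r | Ω r ∈ A}} : ℝ)
      ≤ (Fintype.card X : ℝ) ^ B * Real.exp (-u) := by
  have hX : (0 : ℝ) < Fintype.card X := by exact_mod_cast Fintype.card_pos
  set p : ℝ := #A / Fintype.card X
  have hmom : ∑ Ω : Fin B → X, Real.exp (#{r | Ω r ∈ A} : ℝ)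
      ≤ (Fintype.card X : ℝ) ^ B * Real.exp (2 * B * p) := by
    calc _ = ∑ Ω : Fin B → X, ∏ r, Real.exp (if Ω r ∈ A then 1 else 0) := by
          refine sum_congr rfl fun Ω _ => ?_
          rw [← Real.exp_sum]; simp
      _ = (∑ x : X, Real.exp (if x ∈ A then 1 else 0)) ^ B := by rw [Fintype.sum_pow]
      _ ≤ (Fintype.card X * Real.exp (2 * p)) ^ B := by
          refine pow_le_pow_left₀ (sum_nonneg fun _ _ => (Real.exp_pos _).le) ?_ _
          calc _ ≤ ∑ x : X, (1 + if x ∈ A then (2 : ℝ) else 0) := by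
                refine sum_le_sum fun x _ => ?_
                split_ifs
                · linarith [Real.exp_one_lt_d9]
                · simp
            _ = Fintype.card X * (2 * p + 1) := by
                rw [sum_add_distrib]; simp [p]; field_simp; ring
            _ ≤ _ := mul_le_mul_of_nonneg_left (Real.add_one_le_exp _) hX.le
      _ = _ := by rw [mul_pow, ← Real.exp_nat_mul]; ring_nf
  have h2 : (#{Ω : Fin B → X | 2 * B * p + u ≤ #{r | Ω r ∈ A}} : ℝ)
      ≤ ∑ Ω : Fin B → X, Real.exp (-(2 * B * p + u)) * Real.exp (#{r | Ω r ∈ A} : ℝ) := by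
    rw [card_filter]
    push_cast
    refine sum_le_sum fun Ω _ => ?_
    rw [← Real.exp_add]
    split_ifs with h
    · apply Real.one_le_exp; linarith
    · positivity
  rw [← mul_sum] at h2
  calc _ ≤ _ := h2
    _ ≤ Real.exp (-(2 * B * p + u)) * ((Fintype.card X : ℝ) ^ B * Real.exp (2 * B * p)) := by
      gcongr
    _ = _ := by
      rw [mul_left_comm, ← Real.exp_add]; ring_nf

theorem sq_le_one_add_sum_levels {y : ℝ} (m : ℕ) (hy : y ^ 2 < 4 ^ m) :
    y ^ 2 ≤ 1 + ∑ i ∈ range m, (4 : ℝ) ^ (i + 1) * (if 2 ^ i ≤ |y| then 1 else 0) := by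
  induction m with
  | zero => simp at hy ⊢; linarith
  | succ m ih =>
    rw [sum_range_succ]
    by_cases h : y ^ 2 < 4 ^ m
    · have : (0 : ℝ) ≤ 4 ^ (m + 1) * (if 2 ^ m ≤ |y| then 1 else 0) := by positivity
      linarith [ih h]
    · have h2 : (2 : ℝ) ^ m ≤ |y| := by
        rw [← sq_le_sq₀ (by positivity) (abs_nonneg _), sq_abs, ← pow_mul, mul_comm, pow_mul]
        norm_num
        exact not_lt.1 h
      rw [if_pos h2]
      have : (0 : ℝ) ≤ ∑ i ∈ range m, (4 : ℝ) ^ (i + 1) * (if 2 ^ i ≤ |y| then 1 else 0) := by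
        positivity
      linarith

theorem sum_four_pow_le (m : ℕ) :
    ∑ i ∈ range (m + 1), (4 : ℝ) ^ (i + 1) ≤ 16 / 3 * 4 ^ m := by
  induction m with
  | zero => norm_num
  | succ m ih => 
    rw [sum_range_succ, pow_succ 4 (m + 1)]
    rw [pow_succ] at *
    linarith [pow_pos (show (0 : ℝ) < 4 by norm_num) m]

theorem sum_levels_le (z : ℝ) (m : ℕ) :
    ∑ i ∈ range m, (4 : ℝ) ^ (i + 1) * (if 2 ^ i ≤ |z| then 1 else 0) ≤ 16 / 3 * z ^ 2 := by
  induction m with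
  | zero => simp; positivity
  | succ m ih =>
    by_cases h : (2 : ℝ) ^ m ≤ |z|
    · calc _ ≤ ∑ i ∈ range (m + 1), (4 : ℝ) ^ (i + 1) := by
            refine sum_le_sum fun i _ => mul_le_of_le_one_right (by positivity) ?_
            split_ifs <;> norm_num
        _ ≤ 16 / 3 * 4 ^ m := sum_four_pow_le m
        _ ≤ _ := by
          have : ((2 : ℝ) ^ m) ^ 2 ≤ |z| ^ 2 := pow_le_pow_left₀ (by positivity) h 2
          rw [sq_abs, ← pow_mul, mul_comm, pow_mul] at this
          norm_num at this
          linarith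
    · rw [sum_range_succ, if_neg h]; linarith


/-- The points where the rescaled average of the functions `φ (τ l)` has modulus at
least `(3 / 4) * 2 ^ i`. -/
def averageLevelSet {X ι : Type*} [Fintype X] (φ : ι → X → ℝ) (K : ℝ) (i : ℕ) {L : ℕ}
    (τ : Fin L → ι) : Finset X :=
  open Classical in {x | 3 / 4 * 2 ^ i ≤ √K * |(∑ l, φ (τ l) x) / L|}

/-- A sample is typical if it does not hit any average level set much more often than expected. -/
def TypicalSample {X ι : Type*} [Fintype X] [DecidableEq X] [Fintype ι] (φ : ι → X → ℝ) (K s : ℝ)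
    (n : ℕ) (L : ℕ → ℕ) {B : ℕ} (Ω : Fin B → X) : Prop :=
  ∀ i ∈ range (n + 1), ∀ τ : Fin (L i) → ι,
    (#{r | Ω r ∈ averageLevelSet φ K i τ} : ℝ)
      < 2 * B * (#(averageLevelSet φ K i τ) / Fintype.card X : ℝ)
        + (2 * L i * Real.log (Fintype.card ι) + s)

open Classical in
theorem card_not_typicalSample_le {X ι : Type*} [Fintype X] [DecidableEq X] [Nonempty X]
    [Fintype ι] (φ : ι → X → ℝ) (K s : ℝ) (n : ℕ) (L : ℕ → ℕ) (hL : ∀ i, 0 < L i)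
    (hn : n + 1 ≤ Fintype.card ι) (B : ℕ) :
    (#{Ω : Fin B → X | ¬ TypicalSample φ K s n L Ω} : ℝ)
      ≤ (Fintype.card X : ℝ) ^ B * Real.exp (-s) := by
  have hN : (1 : ℝ) ≤ Fintype.card ι := by
    exact_mod_cast (by omega : 1 ≤ Fintype.card ι)
  have hsub : ({Ω : Fin B → X | ¬ TypicalSample φ K s n L Ω} : Finset (Fin B → X)) ⊆
      (range (n + 1)).biUnion fun i => (univ : Finset (Fin (L i) → ι)).biUnion fun τ =>
        {Ω | 2 * B * (#(averageLevelSet φ K i τ) / Fintype.card X : ℝ)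
          + (2 * L i * Real.log (Fintype.card ι) + s) ≤ #{r | Ω r ∈ averageLevelSet φ K i τ}} := by
    intro Ω hΩ
    simp only [mem_filter, mem_univ, true_and, TypicalSample, not_forall, not_lt] at hΩ
    obtain ⟨i, hi, τ, h⟩ := hΩ
    simp only [mem_biUnion, mem_filter, mem_univ, true_and]
    exact ⟨i, hi, τ, h⟩
  have hlevel : ∀ i, (Fintype.card ι : ℝ) ^ L i *
      Real.exp (-(2 * L i * Real.log (Fintype.card ι) + s))
        ≤ (Fintype.card ι : ℝ)⁻¹ * Real.exp (-s) := by
    intro i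
    rw [neg_add, Real.exp_add, ← mul_assoc]
    refine mul_le_mul_of_nonneg_right ?_ (Real.exp_pos _).le
    have hlog := Real.log_nonneg hN
    have h1 : (1 : ℝ) ≤ L i := by exact_mod_cast hL i
    calc _ = Real.exp (L i * Real.log (Fintype.card ι)) *
          Real.exp (-(2 * L i * Real.log (Fintype.card ι))) := by
          rw [Real.exp_nat_mul, Real.exp_log (by linarith)]
      _ = Real.exp (-(L i * Real.log (Fintype.card ι))) := by
          rw [← Real.exp_add]; ring_nf
      _ ≤ Real.exp (-Real.log (Fintype.card ι)) := by
          apply Real.exp_le_exp.2; nlinarith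
      _ = _ := by rw [Real.exp_neg, Real.exp_log (by linarith)]
  calc _ ≤ ∑ i ∈ range (n + 1), ∑ τ : Fin (L i) → ι,
        (#{Ω : Fin B → X | 2 * B * (#(averageLevelSet φ K i τ) / Fintype.card X : ℝ)
          + (2 * L i * Real.log (Fintype.card ι) + s)
            ≤ #{r | Ω r ∈ averageLevelSet φ K i τ}} : ℝ) := by
        have h := (card_le_card hsub).trans
          (card_biUnion_le.trans (sum_le_sum fun i _ => card_biUnion_le))
        exact_mod_cast h
    _ ≤ ∑ i ∈ range (n + 1), ∑ τ : Fin (L i) → ι, (Fintype.card X : ℝ) ^ B *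
          Real.exp (-(2 * L i * Real.log (Fintype.card ι) + s)) :=
        sum_le_sum fun i _ => sum_le_sum fun τ _ => card_filter_chernoff B _ _
    _ ≤ ∑ i ∈ range (n + 1), (Fintype.card X : ℝ) ^ B *
          ((Fintype.card ι : ℝ)⁻¹ * Real.exp (-s)) := by
        refine sum_le_sum fun i _ => ?_
        simp only [sum_const, card_univ, Fintype.card_pi, prod_const, Fintype.card_fin,
          nsmul_eq_mul]
        push_cast
        rw [mul_left_comm]
        exact mul_le_mul_of_nonneg_left (hlevel i) (by positivity)
    _ = (Fintype.card X : ℝ) ^ B * Real.exp (-s) * ((n + 1) * (Fintype.card ι : ℝ)⁻¹) := by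
        simp only [sum_const, card_range, nsmul_eq_mul]; push_cast; ring
    _ ≤ _ := by
        refine mul_le_of_le_one_right (by positivity) ?_
        rw [← div_eq_mul_inv, div_le_one (by linarith)]
        exact_mod_cast hn

open Classical in
theorem TypicalSample.card_level_le {X ι : Type*} [Fintype X] [DecidableEq X] [Nonempty X]
    [Fintype ι] {φ : ι → X → ℝ} (hφ : ∀ i x, |φ i x| ≤ 1) {K s : ℝ} (hK : 1 ≤ K) {n : ℕ}
    (hn : (4 : ℝ) ^ n ≤ K) {L : ℕ → ℕ} (hL : ∀ i, 0 < L i)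
    (hL' : ∀ i, 256 * K / 4 ^ i * Real.log (4 * K) ≤ L i) {B : ℕ} (hB : 0 < B) {Ω : Fin B → X}
    (hΩ : TypicalSample φ K s n L Ω) {w : ι → ℝ} (hw : ∀ i, 0 ≤ w i) (hw1 : ∑ i, w i = 1)
    {h : X → ℝ} (hh : ∀ x, h x = √K * ∑ i, w i * φ i x) {i : ℕ} (hi : i ∈ range (n + 1)) :
    (#{r | 2 ^ i ≤ |h (Ω r)|} : ℝ) ≤ 2 * B * (#{x | 2 ^ i ≤ |2 * h x|} / Fintype.card X : ℝ)
      + 3 * B / K + 2 * L i * Real.log (Fintype.card ι) + s := by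
  have hX : (0 : ℝ) < Fintype.card X := by exact_mod_cast Fintype.card_pos
  have hB' : (0 : ℝ) < B := by exact_mod_cast hB
  have hK0 : (0 : ℝ) < K := by linarith
  have hsK : 0 < √K := Real.sqrt_pos.2 hK0
  have h4i : (4 : ℝ) ^ i ≤ K :=
    (pow_le_pow_right₀ (by norm_num) (by simpa [Nat.lt_succ_iff] using hi)).trans hn
  have h22 : ((2 : ℝ) ^ i) ^ 2 = 4 ^ i := by rw [← pow_mul, mul_comm, pow_mul]; norm_num
  have h2i : (2 : ℝ) ^ i ≤ √K := by
    apply Real.le_sqrt_of_sq_le; rw [h22]; exact h4i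
  set δ : ℝ := 2 ^ i / (4 * √K) with hδ
  have hδ4 : δ ≤ 4 := by
    rw [hδ, div_le_iff₀ (by positivity)]; linarith
  have hδK : √K * δ = 2 ^ i / 4 := by rw [hδ]; field_simp
  have hδ2 : δ ^ 2 = 4 ^ i / (16 * K) := by
    rw [hδ, div_pow, mul_pow, Real.sq_sqrt hK0.le, h22]; norm_num
  obtain ⟨τ, hτ⟩ := exists_average_approx (Y := X ⊕ Fin B)
    (fun j => Sum.elim (φ j) (fun r => φ j (Ω r)))
    (by rintro j (x | r) <;> simp [hφ]) w hw hw1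
    (Sum.elim (fun _ => (Fintype.card X : ℝ)⁻¹) (fun _ => (B : ℝ)⁻¹))
    (by rintro (x | r) <;> simp) (by positivity : 0 ≤ δ) hδ4 (hL i)
  set bad : X → ℝ := fun x =>
    if δ ≤ |(∑ l, φ (τ l) x) / L i - ∑ j, w j * φ j x| then 1 else 0 with hbad
  have hbad0 : ∀ x, 0 ≤ bad x := fun x => by simp only [hbad]; split_ifs <;> norm_num
  have hexp : Real.exp (-(L i * δ ^ 2 / 16)) ≤ 1 / (4 * K) := by
    rw [← Real.exp_log (show 0 < 1 / (4 * K) by positivity), Real.exp_le_exp, one_div,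
      Real.log_inv, neg_le_neg_iff, hδ2]
    have := hL' i
    rw [div_mul_eq_mul_div, div_le_iff₀ (by positivity)] at this
    rw [mul_div_assoc', div_div, le_div_iff₀ (by positivity)]
    nlinarith
  simp only [Fintype.sum_sum_type, Sum.elim_inl, Sum.elim_inr] at hτ
  rw [← mul_sum, ← mul_sum] at hτ
  change (Fintype.card X : ℝ)⁻¹ * ∑ x, bad x + (B : ℝ)⁻¹ * ∑ r, bad (Ω r) ≤ _ at hτ
  have hsum : (Fintype.card X : ℝ)⁻¹ * ∑ x, bad x + (B : ℝ)⁻¹ * ∑ r, bad (Ω r) ≤ 1 / K := by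
    refine hτ.trans ?_
    simp only [sum_const, card_univ, Fintype.card_fin, nsmul_eq_mul]
    rw [mul_inv_cancel₀ hX.ne', mul_inv_cancel₀ hB'.ne']
    calc _ ≤ (1 + 1) * (2 * (1 / (4 * K))) := by gcongr
      _ = 1 / K := by field_simp; norm_num
  have hbX0 : 0 ≤ (Fintype.card X : ℝ)⁻¹ * ∑ x, bad x :=
    mul_nonneg (by positivity) (sum_nonneg fun x _ => hbad0 x)
  have hbB0 : 0 ≤ (B : ℝ)⁻¹ * ∑ r, bad (Ω r) :=
    mul_nonneg (by positivity) (sum_nonneg fun x _ => hbad0 _)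
  have hclose : ∀ x, bad x = 0 →
      abs (√K * |(∑ l, φ (τ l) x) / L i| - |h x|) ≤ 2 ^ i / 4 := by
    intro x hx
    have hx' : |(∑ l, φ (τ l) x) / L i - ∑ j, w j * φ j x| < δ := by
      by_contra hcon
      simp [hbad, not_lt.1 hcon] at hx
    rw [hh, abs_mul, abs_of_pos hsK, ← mul_sub, abs_mul, abs_of_pos hsK, ← hδK]
    exact mul_le_mul_of_nonneg_left ((abs_abs_sub_abs_le_abs_sub _ _).trans hx'.le) hsK.le
  set A := averageLevelSet φ K i τ with hA
  have hmemA : ∀ x, x ∈ A ↔ 3 / 4 * 2 ^ i ≤ √K * |(∑ l, φ (τ l) x) / L i| := by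
    intro x; simp [hA, averageLevelSet]
  have hbad1 : ∀ x, bad x = 0 ∨ bad x = 1 := fun x => by
    simp only [hbad]; split_ifs <;> simp
  have hup : ∀ x, (if 2 ^ i ≤ |h x| then (1 : ℝ) else 0) ≤ (if x ∈ A then 1 else 0) + bad x := by
    intro x
    rcases hbad1 x with hx | hx
    · have := (abs_le.1 (hclose x hx)).1
      by_cases h1 : 2 ^ i ≤ |h x|
      · rw [if_pos h1, if_pos ((hmemA x).2 (by linarith)), hx]; norm_num
      · rw [if_neg h1, hx]; split_ifs <;> norm_num
    · rw [hx]; split_ifs <;> norm_num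
  have hdown : ∀ x, (if x ∈ A then (1 : ℝ) else 0)
      ≤ (if 2 ^ i ≤ |2 * h x| then 1 else 0) + bad x := by
    intro x
    rcases hbad1 x with hx | hx
    · have := (abs_le.1 (hclose x hx)).2
      by_cases h1 : x ∈ A
      · have h2 := (hmemA x).1 h1
        rw [if_pos h1, if_pos (by rw [abs_mul, abs_two]; linarith), hx]; norm_num
      · rw [if_neg h1, hx]; split_ifs <;> norm_num
    · rw [hx]; split_ifs <;> norm_num
  have hcB : (#{r | 2 ^ i ≤ |h (Ω r)|} : ℝ) ≤ #{r | Ω r ∈ A} + ∑ r, bad (Ω r) := by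
    rw [card_filter, card_filter]
    push_cast
    rw [← sum_add_distrib]
    exact sum_le_sum fun r _ => hup (Ω r)
  have hcX : (#A : ℝ) ≤ #{x | 2 ^ i ≤ |2 * h x|} + ∑ x, bad x := by
    have hA' : (#A : ℝ) = ∑ x, if x ∈ A then 1 else 0 := by simp
    rw [hA', card_filter]
    push_cast
    rw [← sum_add_distrib]
    exact sum_le_sum fun x _ => hdown x
  have hgood := hΩ i hi τ
  rw [← hA] at hgood
  have e1 : ∑ r, bad (Ω r) ≤ B / K := by
    have : (B : ℝ)⁻¹ * ∑ r, bad (Ω r) ≤ 1 / K := by linarith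
    rw [inv_mul_le_iff₀ hB'] at this
    linarith [mul_one_div (B : ℝ) K]
  have e2 : (#A / Fintype.card X : ℝ) ≤ #{x | 2 ^ i ≤ |2 * h x|} / Fintype.card X + 1 / K := by
    have : (#A / Fintype.card X : ℝ) ≤
        (#{x | 2 ^ i ≤ |2 * h x|} + ∑ x, bad x) / Fintype.card X := by gcongr
    rw [add_div, div_eq_inv_mul (∑ x, bad x)] at this
    linarith
  have e3 : 2 * B * (#A / Fintype.card X : ℝ) ≤
      2 * B * (#{x | 2 ^ i ≤ |2 * h x|} / Fintype.card X + 1 / K) := by gcongr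
  have e4 : 2 * (B : ℝ) * (1 / K) + B / K = 3 * B / K := by ring
  linarith

/-- For a typical sample, the sum of squares over the sample of any function in the rescaled
convex hull of the dictionary is controlled uniformly. -/
theorem TypicalSample.sum_sq_le {X ι : Type*} [Fintype X] [DecidableEq X] [Nonempty X]
    [Fintype ι] {φ : ι → X → ℝ} (hφ : ∀ i x, |φ i x| ≤ 1) {K s : ℝ} (hK : 1 ≤ K) (hs : 0 ≤ s)
    {n : ℕ} (hn : (4 : ℝ) ^ n ≤ K) (hn' : K < 4 ^ (n + 1)) {L : ℕ → ℕ} (hL : ∀ i, 0 < L i)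
    (hL' : ∀ i, 256 * K / 4 ^ i * Real.log (4 * K) ≤ L i)
    (hL'' : ∀ i, L i ≤ 256 * K / 4 ^ i * Real.log (4 * K) + 1)
    {B : ℕ} (hB : 0 < B) {Ω : Fin B → X}
    (hΩ : TypicalSample φ K s n L Ω) {w : ι → ℝ} (hw : ∀ i, 0 ≤ w i) (hw1 : ∑ i, w i = 1)
    {h : X → ℝ} (hh : ∀ x, h x = √K * ∑ i, w i * φ i x)
    (hh2 : ∑ x, h x ^ 2 ≤ Fintype.card X) :
    ∑ r, h (Ω r) ^ 2 ≤ 62 * B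
      + 2060 * ((n + 1) * K * Real.log (4 * K) * Real.log (Fintype.card ι)) + 6 * K * s := by
  classical
  have hX : (0 : ℝ) < Fintype.card X := by exact_mod_cast Fintype.card_pos
  have hB' : (0 : ℝ) < B := by exact_mod_cast hB
  have hK0 : (0 : ℝ) < K := by linarith
  set lN := Real.log (Fintype.card ι)
  have hlN : 0 ≤ lN := Real.log_natCast_nonneg _
  have hlK : 1 ≤ Real.log (4 * K) := by
    rw [Real.le_log_iff_exp_le (by positivity)]
    linarith [Real.exp_one_lt_d9]
  have hsq : ∀ x, h x ^ 2 < 4 ^ (n + 1) := by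
    intro x
    refine lt_of_le_of_lt ?_ hn'
    have hm1 : |∑ i, w i * φ i x| ≤ 1 := by
      calc _ ≤ ∑ i, |w i * φ i x| := abs_sum_le_sum_abs _ _
        _ ≤ ∑ i, w i := sum_le_sum fun i _ => by
          rw [abs_mul, abs_of_nonneg (hw i)]
          exact mul_le_of_le_one_right (hw i) (hφ i x)
        _ = 1 := hw1
    rw [hh, mul_pow, Real.sq_sqrt hK0.le]
    exact mul_le_of_le_one_right hK0.le ((sq_le_one_iff_abs_le_one _).2 hm1)
  have hfour : ∑ i ∈ range (n + 1), (4 : ℝ) ^ (i + 1) ≤ 6 * K := by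
    linarith [sum_four_pow_le n]
  have hstep : ∑ r, h (Ω r) ^ 2 ≤
      B + ∑ i ∈ range (n + 1), (4 : ℝ) ^ (i + 1) * #{r | 2 ^ i ≤ |h (Ω r)|} := by
    calc _ ≤ ∑ r : Fin B, (1 + ∑ i ∈ range (n + 1),
          (4 : ℝ) ^ (i + 1) * (if 2 ^ i ≤ |h (Ω r)| then 1 else 0)) :=
          sum_le_sum fun r _ => sq_le_one_add_sum_levels _ (hsq _)
      _ = _ := by
          rw [sum_add_distrib, sum_comm]
          simp only [sum_const, card_univ, Fintype.card_fin, nsmul_eq_mul, mul_one, ← mul_sum,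
            card_filter]
          push_cast
          rfl
  have hpop : ∑ i ∈ range (n + 1), (4 : ℝ) ^ (i + 1) * #{x | 2 ^ i ≤ |2 * h x|}
      ≤ 64 / 3 * Fintype.card X := by
    calc _ = ∑ x, ∑ i ∈ range (n + 1),
          (4 : ℝ) ^ (i + 1) * (if 2 ^ i ≤ |2 * h x| then 1 else 0) := by
          rw [sum_comm]
          simp only [← mul_sum, card_filter]
          push_cast
          rfl
      _ ≤ ∑ x, 16 / 3 * (2 * h x) ^ 2 := sum_le_sum fun x _ => sum_levels_le _ _
      _ = 64 / 3 * ∑ x, h x ^ 2 := by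
          rw [mul_sum]; exact sum_congr rfl fun x _ => by ring
      _ ≤ _ := by gcongr
  have hterm : ∀ i ∈ range (n + 1), (4 : ℝ) ^ (i + 1) * #{r | 2 ^ i ≤ |h (Ω r)|} ≤
      2 * B / Fintype.card X * ((4 : ℝ) ^ (i + 1) * #{x | 2 ^ i ≤ |2 * h x|})
      + (4 : ℝ) ^ (i + 1) * (3 * B / K + 2 * lN + s)
      + 2048 * (K * Real.log (4 * K) * lN) := by
    intro i hi
    have h1 := hΩ.card_level_le hφ hK hn hL hL' hB hw hw1 hh hi
    have h2 : 2 * L i * lN ≤ 2 * (256 * K / 4 ^ i * Real.log (4 * K) + 1) * lN := by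
      gcongr; exact hL'' i
    have h4 : (0 : ℝ) < 4 ^ i := by positivity
    calc _ ≤ (4 : ℝ) ^ (i + 1) * (2 * B * (#{x | 2 ^ i ≤ |2 * h x|} / Fintype.card X : ℝ)
            + 3 * B / K + 2 * (256 * K / 4 ^ i * Real.log (4 * K) + 1) * lN + s) := by
          refine mul_le_mul_of_nonneg_left ?_ (by positivity)
          linarith
      _ = _ := by rw [pow_succ]; field_simp; ring
  have htot := sum_le_sum hterm
  rw [sum_add_distrib, sum_add_distrib, ← mul_sum, ← sum_mul] at htot
  simp only [sum_const, card_range, nsmul_eq_mul] at htot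
  push_cast at htot
  have e1 : 2 * B / Fintype.card X *
      ∑ i ∈ range (n + 1), (4 : ℝ) ^ (i + 1) * #{x | 2 ^ i ≤ |2 * h x|} ≤ 128 / 3 * B := by
    calc _ ≤ 2 * B / Fintype.card X * (64 / 3 * Fintype.card X : ℝ) := by gcongr
      _ = _ := by field_simp; norm_num
  have e2 : (∑ i ∈ range (n + 1), (4 : ℝ) ^ (i + 1)) * (3 * B / K + 2 * lN + s)
      ≤ 18 * B + 12 * (K * lN) + 6 * K * s := by
    calc _ ≤ 6 * K * (3 * B / K + 2 * lN + s) := by gcongr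
      _ = _ := by field_simp; ring
  have e3 : K * lN ≤ (n + 1) * K * Real.log (4 * K) * lN := by
    have h1 : (1 : ℝ) ≤ n + 1 := by linarith [Nat.cast_nonneg (α := ℝ) n]
    have h2 : 1 ≤ (n + 1) * Real.log (4 * K) := one_le_mul_of_one_le_of_one_le h1 hlK
    nlinarith [mul_nonneg hK0.le hlN]
  linarith


theorem norm_Fmat (d : ℕ) (j k : Fin d) : ‖Fmat d j k‖ = 1 := by
  have : Fmat d j k = Complex.exp (((2 * Real.pi * j.1 * k.1 / d : ℝ) : ℂ) * Complex.I) := by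
    unfold Fmat; congr 1; push_cast; ring
  rw [this, Complex.norm_exp_ofReal_mul_I]

theorem Fmat_eq_pow (d : ℕ) (j k : Fin d) :
    Fmat d j k = (Complex.exp (2 * Real.pi * Complex.I / d) ^ (k : ℕ)) ^ (j : ℕ) := by
  rw [← Complex.exp_nat_mul, ← Complex.exp_nat_mul]
  unfold Fmat; congr 1; ring

theorem sum_Fmat_mul_conj (d : ℕ) (j k : Fin d) :
    ∑ r, Fmat d r j * (starRingEnd ℂ) (Fmat d r k) = if j = k then (d : ℂ) else 0 := by
  have hd : d ≠ 0 := by have := j.2; omega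
  split_ifs with h
  · subst h
    simp [Complex.mul_conj, Complex.normSq_eq_norm_sq, norm_Fmat]
  · set ζ := Complex.exp (2 * Real.pi * Complex.I / d)
    have hζ : IsPrimitiveRoot ζ d := Complex.isPrimitiveRoot_exp d hd
    have hz0 : ζ ^ (k : ℕ) ≠ 0 := pow_ne_zero _ (Complex.exp_ne_zero _)
    have hnorm : ‖ζ ^ (k : ℕ)‖ = 1 := by rw [norm_pow, hζ.norm'_eq_one hd, one_pow]
    have hconj : (starRingEnd ℂ) (ζ ^ (k : ℕ)) = (ζ ^ (k : ℕ))⁻¹ :=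
      (Complex.inv_eq_conj hnorm).symm
    set z := ζ ^ (j : ℕ) * (ζ ^ (k : ℕ))⁻¹ with hz
    have hz1 : z ≠ 1 := by
      intro h1
      rw [hz, mul_inv_eq_one₀ hz0] at h1
      exact h (Fin.ext (hζ.pow_inj j.2 k.2 h1))
    have hzd : z ^ d = 1 := by
      have hpow : ∀ m : ℕ, (ζ ^ m) ^ d = 1 := fun m => by
        rw [← pow_mul, mul_comm, pow_mul, hζ.pow_eq_one, one_pow]
      rw [hz, mul_pow, inv_pow, hpow, hpow, inv_one, one_mul]
    calc _ = ∑ r : Fin d, z ^ (r : ℕ) := by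
          refine sum_congr rfl fun r _ => ?_
          rw [Fmat_eq_pow, Fmat_eq_pow, map_pow, hconj, ← mul_pow]
      _ = ∑ r ∈ range d, z ^ r := Fin.sum_univ_eq_sum_range (fun r => z ^ r) d
      _ = 0 := by
          have := mul_geom_sum z d
          rw [hzd, sub_self] at this
          exact (mul_eq_zero.1 this).resolve_left (sub_ne_zero.2 hz1)

/-- Parseval's identity for the unnormalised Fourier matrix. -/
theorem sum_norm_sq_mvec_Fmat (d : ℕ) (x : Fin d → ℂ) :
    ∑ r, ‖mvec (Fmat d) x r‖ ^ 2 = d * ∑ j, ‖x j‖ ^ 2 := by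
  have h : ∑ r, mvec (Fmat d) x r * (starRingEnd ℂ) (mvec (Fmat d) x r)
      = d * ∑ j, x j * (starRingEnd ℂ) (x j) := by
    calc _ = ∑ j, ∑ k, x j * (starRingEnd ℂ) (x k) *
          ∑ r, Fmat d r j * (starRingEnd ℂ) (Fmat d r k) := by
          simp only [mvec, map_sum, map_mul]
          simp only [sum_mul_sum]
          simp only [mul_sum]
          rw [sum_comm]
          refine sum_congr rfl fun j _ => ?_
          rw [sum_comm]
          exact sum_congr rfl fun k _ => sum_congr rfl fun r _ => by ring
      _ = _ := by
          simp only [sum_Fmat_mul_conj, mul_ite, mul_zero, sum_ite_eq, mem_univ, if_true, mul_sum]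
          exact sum_congr rfl fun j _ => by ring
  simp only [Complex.mul_conj, Complex.normSq_eq_norm_sq] at h
  exact_mod_cast h

/-- The dictionary of signed real and imaginary parts of the columns of the Fourier matrix,
together with the zero function. -/
def fourierDict (d : ℕ) : Option (Fin d × Fin 4) → Fin d → ℝ
  | none, _ => 0
  | some (j, σ), r => ![(Fmat d r j).re, -(Fmat d r j).im, -(Fmat d r j).re, (Fmat d r j).im] σ

theorem abs_fourierDict_le (d : ℕ) (i : Option (Fin d × Fin 4)) (r : Fin d) :
    |fourierDict d i r| ≤ 1 := by
  rcases i with _ | ⟨j, σ⟩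
  · simp [fourierDict]
  · have h1 := Complex.abs_re_le_norm (Fmat d r j)
    have h2 := Complex.abs_im_le_norm (Fmat d r j)
    rw [norm_Fmat] at h1 h2
    fin_cases σ <;> simpa [fourierDict]

/-- The real part of the Fourier transform of a sparse vector in the unit ball is a rescaled convex
combination of dictionary elements. -/
theorem exists_weights_re_mvec_Fmat {d k : ℕ} (hk : 0 < k) {S : Finset (Fin d)} (hS : #S = k)
    {x : Fin d → ℂ} (hxS : ∀ j ∉ S, x j = 0) (hx : ∑ j, ‖x j‖ ^ 2 ≤ 1) :
    ∃ w : Option (Fin d × Fin 4) → ℝ, (∀ i, 0 ≤ w i) ∧ ∑ i, w i = 1 ∧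
      ∀ r, (mvec (Fmat d) x r).re = √(4 * k) * ∑ i, w i * fourierDict d i r := by
  have hK : (0 : ℝ) < √(4 * k) := Real.sqrt_pos.2 (by positivity)
  set c : Fin d × Fin 4 → ℝ := fun p =>
    ![max (x p.1).re 0, max (x p.1).im 0, max (-(x p.1).re) 0, max (-(x p.1).im) 0] p.2 with hc
  have hc0 : ∀ p, 0 ≤ c p := by
    rintro ⟨j, σ⟩; fin_cases σ <;> simp [hc]
  have habs : ∀ a : ℝ, max a 0 + max (-a) 0 = |a| := fun a => by
    rcases le_total 0 a with h | h
    · rw [max_eq_left h, max_eq_right (by linarith), abs_of_nonneg h, add_zero]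
    · rw [max_eq_right h, max_eq_left (by linarith), abs_of_nonpos h, zero_add]
  have hcsum : ∑ p, c p ≤ √(4 * k) := by
    have h1 : ∑ p, c p ≤ 2 * ∑ j, ‖x j‖ := by
      rw [Fintype.sum_prod_type, mul_sum]
      refine sum_le_sum fun j _ => ?_
      simp only [hc, Fin.sum_univ_four, Matrix.cons_val]
      linarith [habs (x j).re, habs (x j).im, Complex.abs_re_le_norm (x j),
        Complex.abs_im_le_norm (x j)]
    have h2 : ∑ j, ‖x j‖ = ∑ j ∈ S, ‖x j‖ :=
      (sum_subset (subset_univ S) fun j _ hj => by simp [hxS j hj]).symm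
    have h3 : (∑ j ∈ S, ‖x j‖) ^ 2 ≤ k := by
      calc _ ≤ #S * ∑ j ∈ S, ‖x j‖ ^ 2 := sq_sum_le_card_mul_sum_sq
        _ ≤ #S * ∑ j, ‖x j‖ ^ 2 := by
          gcongr; exact subset_univ S
        _ ≤ #S * 1 := by gcongr
        _ = k := by rw [hS, mul_one]
    refine h1.trans (Real.le_sqrt_of_sq_le ?_)
    rw [h2]; nlinarith
  refine ⟨fun i => i.elim (1 - (∑ p, c p) / √(4 * k)) (fun p => c p / √(4 * k)), ?_, ?_, ?_⟩
  · rintro (_ | p)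
    · simpa using (div_le_one hK).2 hcsum
    · exact div_nonneg (hc0 p) hK.le
  · simp [Fintype.sum_option, ← sum_div]
  · intro r
    simp only [Fintype.sum_option, Option.elim, fourierDict, mul_zero, zero_add]
    rw [mul_sum, Fintype.sum_prod_type]
    simp only [mvec, Complex.re_sum]
    refine sum_congr rfl fun j _ => ?_
    have e : ∀ a b : ℝ, √(4 * k) * (a / √(4 * k) * b) = a * b := fun a b => by field_simp
    simp only [e, hc, Fin.sum_univ_four, Matrix.cons_val, Complex.mul_re]
    have h1 := max_zero_sub_max_neg_zero_eq_self (x j).re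
    have h2 := max_zero_sub_max_neg_zero_eq_self (x j).im
    linear_combination (-(Fmat d r j).re) * h1 + (Fmat d r j).im * h2

/-- Typical samples give the restricted operator norm bound. -/
theorem TypicalSample.sum_norm_sq_mvec_le {d k B n : ℕ} (hd : 0 < d) (hk : 0 < k) (hB : 0 < B)
    {s : ℝ} (hs : 0 ≤ s) (hn : (4 : ℝ) ^ n ≤ 4 * k) (hn' : (4 * k : ℝ) < 4 ^ (n + 1))
    {Ω : Fin B → Fin d}
    (hΩ : TypicalSample (fourierDict d) (4 * k) s n
      (fun i => ⌈256 * (4 * k : ℝ) / 4 ^ i * Real.log (4 * (4 * k))⌉₊) Ω)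
    {S : Finset (Fin d)} (hS : #S = k) {x : Fin d → ℂ} (hxS : ∀ j ∉ S, x j = 0)
    (hx : ∑ j, ‖x j‖ ^ 2 ≤ 1) :
    ∑ r, ‖mvec (Fmat d) x (Ω r)‖ ^ 2 ≤ 2 * (62 * B
      + 2060 * ((n + 1) * (4 * k) * Real.log (4 * (4 * k)) * Real.log (4 * d + 1))
      + 6 * (4 * k) * s) := by
  have : Nonempty (Fin d) := ⟨⟨0, hd⟩⟩
  have hk1 : (1 : ℝ) ≤ k := by exact_mod_cast hk
  have hlog : 0 < Real.log (4 * (4 * k)) := Real.log_pos (by linarith)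
  have key : ∀ y : Fin d → ℂ, (∀ j ∉ S, y j = 0) → ∑ j, ‖y j‖ ^ 2 ≤ 1 →
      ∑ r, (mvec (Fmat d) y (Ω r)).re ^ 2 ≤ 62 * B
        + 2060 * ((n + 1) * (4 * k) * Real.log (4 * (4 * k)) * Real.log (4 * d + 1))
        + 6 * (4 * k) * s := by
    intro y hyS hy
    obtain ⟨w, hw, hw1, hrep⟩ := exists_weights_re_mvec_Fmat hk hS hyS hy
    have hN : ((Fintype.card (Option (Fin d × Fin 4)) : ℕ) : ℝ) = 4 * d + 1 := by
      simp [mul_comm]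
    rw [← hN]
    refine hΩ.sum_sq_le (abs_fourierDict_le d) (by linarith) hs hn hn'
      (fun i => Nat.ceil_pos.2 (by positivity)) (fun i => Nat.le_ceil _)
      (fun i => (Nat.ceil_lt_add_one (by positivity)).le) hB hw hw1
      (h := fun r => (mvec (Fmat d) y r).re) hrep ?_
    calc _ ≤ ∑ r, ‖mvec (Fmat d) y r‖ ^ 2 := sum_le_sum fun r _ => by
          rw [← sq_abs]
          exact pow_le_pow_left₀ (abs_nonneg _) (Complex.abs_re_le_norm _) 2
      _ = d * ∑ j, ‖y j‖ ^ 2 := sum_norm_sq_mvec_Fmat d y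
      _ ≤ d * 1 := by gcongr
      _ = _ := by simp
  have h1 := key x hxS hx
  have h2 := key (fun j => -Complex.I * x j) (fun j hj => by simp [hxS j hj])
    (by simpa [norm_mul] using hx)
  have h3 : ∀ r, ‖mvec (Fmat d) x r‖ ^ 2 = (mvec (Fmat d) x r).re ^ 2
      + (mvec (Fmat d) (fun j => -Complex.I * x j) r).re ^ 2 := by
    intro r
    have : mvec (Fmat d) (fun j => -Complex.I * x j) r = -Complex.I * mvec (Fmat d) x r := by
      simp only [mvec, mul_sum]
      exact sum_congr rfl fun j _ => by ring
    rw [this, Complex.sq_norm, Complex.normSq_apply]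
    simp
    ring
  simp only [h3, sum_add_distrib]
  linarith

theorem entropy_factor_le {d k n : ℕ} (hd : 2 ≤ d) (hk : 2 ≤ k) (hn : (4 : ℝ) ^ n ≤ 4 * k) :
    (n + 1) * (4 * k) * Real.log (4 * (4 * k)) * Real.log (4 * d + 1)
      ≤ 400 * (k * (Real.log k ^ 2 * Real.log d)) := by
  have hk' : (2 : ℝ) ≤ k := by exact_mod_cast hk
  have hd' : (2 : ℝ) ≤ d := by exact_mod_cast hd
  have h2 := Real.log_two_gt_d9
  have hlk : Real.log 2 ≤ Real.log k := Real.log_le_log (by norm_num) hk'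
  have hld : Real.log 2 ≤ Real.log d := Real.log_le_log (by norm_num) hd'
  have h4 : Real.log 4 = 2 * Real.log 2 := by
    rw [show (4 : ℝ) = 2 ^ 2 by norm_num, Real.log_pow]; norm_num
  have e1 : Real.log (4 * (4 * k)) ≤ 5 * Real.log k := by
    rw [Real.log_mul (by norm_num) (by positivity), Real.log_mul (by norm_num) (by positivity)]
    linarith
  have e2 : Real.log (4 * d + 1) ≤ 4 * Real.log d := by
    calc _ ≤ Real.log (4 * (2 * d)) := Real.log_le_log (by positivity) (by linarith)
      _ ≤ _ := by
        rw [Real.log_mul (by norm_num) (by positivity), Real.log_mul (by norm_num) (by positivity)]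
        linarith
  have e3 : (n : ℝ) + 1 ≤ 5 * Real.log k := by
    have := Real.log_le_log (by positivity) hn
    rw [Real.log_pow, Real.log_mul (by norm_num) (by positivity)] at this
    have hn0 : (0 : ℝ) ≤ n := Nat.cast_nonneg n
    nlinarith
  have e0 : 0 ≤ Real.log (4 * d + 1) := Real.log_nonneg (by linarith)
  have e0' : 0 ≤ Real.log (4 * (4 * k)) := Real.log_nonneg (by linarith)
  calc _ ≤ (5 * Real.log k) * (4 * k) * (5 * Real.log k) * (4 * Real.log d) := by gcongr
    _ = _ := by ring

/-- Lemma `large-RV`, implicit in RV08: for a random multiset `Ω` of `B`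
uniform rows of the Fourier matrix, with `β = log²k·log d·log B`, for every `t > 1`, with
probability at least `1 − C'exp(−c·min{t², tβ})`,
`max_{|S|=k}‖ℱ_{Ω×S}‖_{2→2} ≤ C√(t(B + kβ))`. -/
theorem stmt13 :
    ∃ C C' c : ℝ, 0 < C ∧ 0 < C' ∧ 0 < c ∧
      ∀ (d B k : ℕ), ∀ (hd : 0 < d), 0 < B → 0 < k →
        ∀ t : ℝ, 1 < t →
          haveI : Nonempty (Fin d) := ⟨⟨0, hd⟩⟩
          (PMF.uniformOfFintype (Fin B → Fin d)).toMeasure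
              {Ω | ∀ S : Finset (Fin d), S.card = k →
                ∀ x : Fin d → ℂ, (∀ j ∉ S, x j = 0) → l2norm x ≤ 1 →
                  l2norm (mvec (fun (r : Fin B) (j : Fin d) => Fmat d (Ω r) j) x)
                    ≤ C * Real.sqrt (t * ((B : ℝ) +
                        (k : ℝ) * ((Real.log k) ^ 2 * Real.log d * Real.log B)))}
            ≥ ENNReal.ofReal (1 - C' * Real.exp (-(c * min (t ^ 2)
                (t * ((Real.log k) ^ 2 * Real.log d * Real.log B))))) := by
  refine ⟨2000, 1, 1, by norm_num, by norm_num, by norm_num, ?_⟩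
  intro d B k hd hB hk t ht
  have hne : Nonempty (Fin d) := ⟨⟨0, hd⟩⟩
  set β : ℝ := Real.log k ^ 2 * Real.log d * Real.log B with hβ
  set P := (PMF.uniformOfFintype (Fin B → Fin d)).toMeasure
  have hP : IsProbabilityMeasure P := PMF.toMeasure.isProbabilityMeasure _
  by_cases hkd : k ≤ d
  swap
  · refine le_trans ?_ (measure_mono (s := Set.univ) ?_)
    · rw [measure_univ, ENNReal.ofReal_le_one]
      have := Real.exp_pos (-(1 * min (t ^ 2) (t * β)))
      linarith
    · intro Ω _ S hS
      have := card_le_univ S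
      rw [Fintype.card_fin] at this
      omega
  have hβ0 : 0 ≤ β := mul_nonneg (mul_nonneg (sq_nonneg _) (Real.log_natCast_nonneg _))
    (Real.log_natCast_nonneg _)
  rcases hβ0.eq_or_lt with h0 | hβpos
  · rw [← h0, mul_zero, mul_zero, min_eq_right (sq_nonneg t)]
    simp
  have two_le : ∀ m : ℕ, 0 < m → Real.log m ≠ 0 → 2 ≤ m := by
    intro m hm h
    by_contra hcon
    obtain rfl : m = 1 := by omega
    simp at h
  have hk2 : 2 ≤ k := two_le k hk fun h => by simp [hβ, h] at hβpos
  have hd2 : 2 ≤ d := two_le d hd fun h => by simp [hβ, h] at hβpos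
  have hB2 : 2 ≤ B := two_le B hB fun h => by simp [hβ, h] at hβpos
  have hs : 0 ≤ t * β := by positivity
  set n := Nat.log 4 (4 * k)
  have hn : (4 : ℝ) ^ n ≤ 4 * k := by
    exact_mod_cast Nat.pow_log_le_self 4 (show 4 * k ≠ 0 by omega)
  have hn' : (4 * k : ℝ) < 4 ^ (n + 1) := by
    exact_mod_cast Nat.lt_pow_succ_log_self (show 1 < 4 by norm_num) (4 * k)
  have hcard : n + 1 ≤ Fintype.card (Option (Fin d × Fin 4)) := by
    have h1 : n < 4 ^ n := Nat.lt_pow_self (by norm_num)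
    have h2 : 4 ^ n ≤ 4 * k := Nat.pow_log_le_self 4 (show 4 * k ≠ 0 by omega)
    simp
    omega
  set L : ℕ → ℕ := fun i => ⌈256 * (4 * k : ℝ) / 4 ^ i * Real.log (4 * (4 * k))⌉₊ with hLdef
  have hL : ∀ i, 0 < L i := by
    intro i
    have hk1 : (1 : ℝ) ≤ k := by exact_mod_cast hk
    have hlog : 0 < Real.log (4 * (4 * k)) := Real.log_pos (by linarith)
    exact Nat.ceil_pos.2 (by positivity)
  classical
  set bad : Finset (Fin B → Fin d) :=
    {Ω | ¬ TypicalSample (fourierDict d) (4 * k) (t * β) n L Ω} with hbad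
  have hbadcard : (#bad : ℝ) ≤ (Fintype.card (Fin d) : ℝ) ^ B * Real.exp (-(t * β)) :=
    card_not_typicalSample_le (fourierDict d) (4 * k) (t * β) n L hL hcard B
  have hPbad : P (bad : Set (Fin B → Fin d)) ≤ ENNReal.ofReal (Real.exp (-(t * β))) := by
    rw [PMF.toMeasure_uniformOfFintype_apply _ bad.measurableSet]
    have hc : (0 : ℝ) < Fintype.card (Fin B → Fin d) := by exact_mod_cast Fintype.card_pos
    rw [← ENNReal.ofReal_natCast, ← ENNReal.ofReal_natCast, ← ENNReal.ofReal_div_of_pos hc]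
    refine ENNReal.ofReal_le_ofReal ?_
    rw [div_le_iff₀ hc]
    simp only [Fintype.card_pi, prod_const, card_univ, Fintype.card_fin] at hbadcard ⊢
    push_cast
    rw [mul_comm]
    simpa using hbadcard
  have hgood : ENNReal.ofReal (1 - Real.exp (-(t * β))) ≤ P (bad : Set (Fin B → Fin d))ᶜ := by
    rw [prob_compl_eq_one_sub bad.measurableSet, ENNReal.ofReal_sub _ (Real.exp_pos _).le,
      ENNReal.ofReal_one]
    exact tsub_le_tsub_left hPbad _
  refine le_trans ?_ (hgood.trans (measure_mono ?_))
  · refine ENNReal.ofReal_le_ofReal ?_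
    have : Real.exp (-(t * β)) ≤ Real.exp (-(1 * min (t ^ 2) (t * β))) := by
      rw [Real.exp_le_exp, one_mul]
      exact neg_le_neg (min_le_right _ _)
    linarith
  · intro Ω hΩ S hS x hxS hx
    have hΩ' : TypicalSample (fourierDict d) (4 * k) (t * β) n L Ω := by
      simpa [hbad] using hΩ
    have hx' : ∑ j, ‖x j‖ ^ 2 ≤ 1 := Real.sqrt_le_one.1 hx
    have h1 := hΩ'.sum_norm_sq_mvec_le hd hk hB hs hn hn' hS hxS hx'
    have h2 := entropy_factor_le hd2 hk2 hn
    have hlB : (1 / 2 : ℝ) ≤ Real.log B := by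
      have := Real.log_le_log (by norm_num) (show (2 : ℝ) ≤ B by exact_mod_cast hB2)
      linarith [Real.log_two_gt_d9]
    have h3 : Real.log k ^ 2 * Real.log d ≤ 2 * β := by
      have : 0 ≤ Real.log k ^ 2 * Real.log d :=
        mul_nonneg (sq_nonneg _) (Real.log_natCast_nonneg _)
      rw [hβ]
      nlinarith
    have h4 : k * (Real.log k ^ 2 * Real.log d) ≤ 2 * (k * β) := by
      have := mul_le_mul_of_nonneg_left h3 (Nat.cast_nonneg (α := ℝ) k)
      linarith
    have h5 : (B : ℝ) ≤ t * B := le_mul_of_one_le_left (Nat.cast_nonneg _) ht.le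
    have h6 : (k : ℝ) * β ≤ t * (k * β) := le_mul_of_one_le_left (by positivity) ht.le
    have h7 : 0 ≤ t * (B : ℝ) := by positivity
    have h8 : 0 ≤ t * (k * β) := by positivity
    have hfin : ∑ r, ‖mvec (Fmat d) x (Ω r)‖ ^ 2 ≤ 2000 ^ 2 * (t * (B + k * β)) := by
      linarith
    calc _ = √(∑ r, ‖mvec (Fmat d) x (Ω r)‖ ^ 2) := rfl
      _ ≤ √(2000 ^ 2 * (t * (B + k * β))) := Real.sqrt_le_sqrt hfin
      _ = 2000 * √(t * (B + k * β)) := by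
        rw [Real.sqrt_mul (by norm_num), Real.sqrt_sq (by norm_num)]

end
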